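/- arXiv:math/0309165 — 2 statements merged into one kernel-verified Lean document; each statement's English description precedes it below -/
import Mathlib

section
/- If Q is a homogeneous set of finitary relations on a nonempty set A, then ⟨Q⟩_{KA,∩} = sInv Aut Q. -/
open FirstOrder

/-- A finitary relation on `A` of arity `m+1` (so all arities are ≥ 1). -/
def Rels (A : Type*) : Type _ := Σ m : ℕ, Set (Fin (m + 1) → A)

/-- The image `g[ρ]` of a relation under a permutation. -/
def permImage {A : Type*} (g : Equiv.Perm A) {m : ℕ} (ρ : Set (Fin m → A)) :
    Set (Fin m → A) := (fun a => ⇑g ∘ a) '' ρ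

/-- `Aut R`: permutations strongly preserving every relation in `R`. -/
def AutR {A : Type*} (R : Set (Rels A)) : Set (Equiv.Perm A) :=
  {g | ∀ ρ ∈ R, permImage g ρ.2 = ρ.2}

/-- `sInv G`: relations strongly invariant under every permutation in `G`. -/
def sInvG {A : Type*} (G : Set (Equiv.Perm A)) : Set (Rels A) :=
  {ρ | ∀ g ∈ G, permImage g ρ.2 = ρ.2}

/-- The language with relation symbols `P i` of arity `k i`, for `i : Fin n`. -/
def relLang (n : ℕ) (k : Fin n → ℕ) : Language where
  Functions := fun _ => Empty
  Relations := fun m => {i : Fin n // k i = m}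

/-- The structure on `A` interpreting `P i` as `ρ i`. -/
def relStruct {A : Type*} {n : ℕ} {k : Fin n → ℕ}
    (ρ : ∀ i : Fin n, Set (Fin (k i) → A)) : (relLang n k).Structure A where
  funMap := fun f _ => f.elim
  RelMap := fun {m} r x => (fun j => x (Fin.cast r.2 j)) ∈ ρ r.1

/-- The logical operation given by a first-order formula `φ` with `m` free
variables, applied to the relations `ρ i`. -/
def logicalOp {A : Type*} {n : ℕ} {k : Fin n → ℕ}
    (ρ : ∀ i : Fin n, Set (Fin (k i) → A)) {m : ℕ}
    (φ : (relLang n k).Formula (Fin m)) : Set (Fin m → A) :=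
  letI := relStruct ρ
  {a | φ.Realize a}

/-- `R` is closed under all logical operations (i.e. `R` is a Krasner algebra). -/
def KrasnerClosed {A : Type*} (R : Set (Rels A)) : Prop :=
  ∀ (n : ℕ) (k : Fin n → ℕ) (ρ : ∀ i : Fin n, Set (Fin (k i + 1) → A)),
    (∀ i, (⟨k i, ρ i⟩ : Rels A) ∈ R) →
    ∀ (m : ℕ) (φ : (relLang n (fun i => k i + 1)).Formula (Fin (m + 1))),
      (⟨m, logicalOp ρ φ⟩ : Rels A) ∈ R

/-- `R` is ∩-closed: it contains each `A^m` and is closed under arbitrary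
intersections of relations of equal arity. -/
def InterClosed {A : Type*} (R : Set (Rels A)) : Prop :=
  (∀ m : ℕ, (⟨m, Set.univ⟩ : Rels A) ∈ R) ∧
  ∀ (m : ℕ) (Q : Set (Set (Fin (m + 1) → A))),
    (∀ ρ ∈ Q, (⟨m, ρ⟩ : Rels A) ∈ R) → (⟨m, ⋂₀ Q⟩ : Rels A) ∈ R

/-- `⟨Q⟩_{KA,∩}`: the least ∩-closed Krasner algebra containing `Q`. -/
def KAInterClosure {A : Type*} (Q : Set (Rels A)) : Set (Rels A) :=
  ⋂₀ {R | Q ⊆ R ∧ KrasnerClosed R ∧ InterClosed R}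

/-- `f` (restricted to `s`) is a partial automorphism of `Q`. -/
def IsPartialAuto {A : Type*} (Q : Set (Rels A)) (s : Set A) (f : A → A) : Prop :=
  Set.InjOn f s ∧ ∀ ρ ∈ Q, ∀ a : Fin ((Sigma.fst ρ) + 1) → A,
    (∀ i, a i ∈ s) → (a ∈ ρ.2 ↔ f ∘ a ∈ ρ.2)

/-- `Q` is homogeneous: every finite partial automorphism of `Q` extends to an
automorphism of `Q`. -/
def Homogeneous {A : Type*} (Q : Set (Rels A)) : Prop :=
  ∀ (s : Set A), s.Finite → ∀ f : A → A, IsPartialAuto Q s f →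
    ∃ g ∈ AutR Q, ∀ x ∈ s, g x = f x

theorem aux_perm {A : Type*} (g : Equiv.Perm A) {m : ℕ} (ρ : Set (Fin m → A)) :
    permImage g ρ = ρ ↔ ∀ a, a ∈ ρ ↔ ⇑g ∘ a ∈ ρ := by
  have hinj : Function.Injective (fun a : Fin m → A => ⇑g ∘ a) :=
    fun a b h => funext fun i => g.injective (congrFun h i)
  unfold permImage
  constructor
  · intro h a
    constructor
    · intro ha
      rw [← h]
      exact ⟨a, ha, rfl⟩
    · intro ha
      rw [← h] at ha
      obtain ⟨b, hb, hab⟩ := ha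
      rwa [← hinj hab]
  · intro h
    ext a
    constructor
    · rintro ⟨b, hb, rfl⟩
      exact (h b).1 hb
    · intro ha
      have he : ⇑g ∘ (⇑g.symm ∘ a) = a := by ext i; simp
      refine ⟨⇑g.symm ∘ a, ?_, he⟩
      rw [h, he]
      exact ha

theorem aux_krasner {A : Type*} (G : Set (Equiv.Perm A)) : KrasnerClosed (sInvG G) := by
  intro n k ρ hρ m φ g hg
  rw [aux_perm]
  intro a
  letI := relStruct ρ
  let e : (relLang n (fun i => k i + 1)).Equiv A A :=
    { g with
      map_fun' := fun f _ => f.elim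
      map_rel' := by
        intro N r x
        exact ((aux_perm g _).1 (hρ r.1 g hg) _).symm }
  exact (Language.StrongHomClass.realize_formula e φ (v := a)).symm

theorem aux_inter {A : Type*} (G : Set (Equiv.Perm A)) : InterClosed (sInvG G) := by
  constructor
  · intro m g hg
    rw [aux_perm]
    intro a
    simp
  · intro m Q h g hg
    rw [aux_perm]
    intro a
    simp only [Set.mem_sInter]
    exact forall₂_congr fun σ hσ => (aux_perm g _).1 (h σ hσ g hg) a

theorem aux_subst {A : Type*} {R : Set (Rels A)} (hR : KrasnerClosed R) {k m : ℕ}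
    (σ : Set (Fin (k + 1) → A)) (hσ : (⟨k, σ⟩ : Rels A) ∈ R) (h : Fin (k + 1) → Fin (m + 1)) :
    (⟨m, {x | x ∘ h ∈ σ}⟩ : Rels A) ∈ R := by
  let r : (relLang 1 (fun _ => k + 1)).Relations (k + 1) := ⟨0, rfl⟩
  have := hR 1 (fun _ => k) (fun _ => σ) (fun _ => hσ) m
    (r.formula (fun i => Language.Term.var (h i)))
  convert this using 2
  ext x
  letI := relStruct (fun _ : Fin 1 => σ)
  have h1 := Language.Formula.realize_rel (M := A) (R := r) (v := x)
    (ts := fun i => Language.Term.var (h i))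
  exact h1.symm

theorem aux_compl {A : Type*} {R : Set (Rels A)} (hR : KrasnerClosed R) {m : ℕ}
    (σ : Set (Fin (m + 1) → A)) (hσ : (⟨m, σ⟩ : Rels A) ∈ R) :
    (⟨m, σᶜ⟩ : Rels A) ∈ R := by
  let r : (relLang 1 (fun _ => m + 1)).Relations (m + 1) := ⟨0, rfl⟩
  have := hR 1 (fun _ => m) (fun _ => σ) (fun _ => hσ) m
    (r.formula (fun i => Language.Term.var i)).not
  convert this using 2
  ext x
  letI := relStruct (fun _ : Fin 1 => σ)
  have h1 := Language.Formula.realize_rel (M := A) (R := r) (v := x)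
    (ts := fun i => Language.Term.var i)
  exact not_congr h1.symm

theorem aux_eq {A : Type*} {R : Set (Rels A)} (hR : KrasnerClosed R) {m : ℕ}
    (i j : Fin (m + 1)) :
    (⟨m, {x | x i = x j}⟩ : Rels A) ∈ R := by
  have := hR 0 Fin.elim0 (fun i => i.elim0) (fun i => i.elim0) m
    ((Language.Term.var i).equal (Language.Term.var j))
  convert this using 2
  ext x
  letI := relStruct (A := A) (k := fun i : Fin 0 => Fin.elim0 i + 1) (fun i => i.elim0)
  have h1 := Language.Formula.realize_equal (M := A)
    (L := relLang 0 (fun i : Fin 0 => Fin.elim0 i + 1))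
    (t₁ := Language.Term.var i) (t₂ := Language.Term.var j) (x := x)
  exact h1.symm

/-- If `Q` is a homogeneous set of finitary relations on a
nonempty set `A`, then `⟨Q⟩_{KA,∩} = sInv Aut Q`. -/
theorem stmt4 {A : Type*} [Nonempty A] (Q : Set (Rels A)) (hQ : Homogeneous Q) :
    KAInterClosure Q = sInvG (AutR Q) := by
  classical
  apply Set.Subset.antisymm
  · apply Set.sInter_subset_of_mem
    exact ⟨fun ρ hρ g hg => hg ρ hρ, aux_krasner _, aux_inter _⟩
  · rintro ⟨m, ρ⟩ hρ R ⟨hQR, hK, hI⟩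
    have key : ∀ b c : Fin (m + 1) → A,
        (∀ σ, (⟨m, σ⟩ : Rels A) ∈ R → b ∈ σ → c ∈ σ) → c ∈ ρ → b ∈ ρ := by
      intro b c H hc
      have H2 : ∀ σ, (⟨m, σ⟩ : Rels A) ∈ R → (b ∈ σ ↔ c ∈ σ) := fun σ hσ =>
        ⟨H σ hσ, fun h => by_contra fun hb => H _ (aux_compl hK σ hσ) hb h⟩
      let f : A → A := fun x => if h : ∃ i, b i = x then c h.choose else x
      have hf : ∀ i, f (b i) = c i := by
        intro i
        have hex : ∃ j, b j = b i := ⟨i, rfl⟩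
        have : f (b i) = c hex.choose := dif_pos hex
        rw [this]
        exact (H2 _ (aux_eq hK hex.choose i)).1 hex.choose_spec
      obtain ⟨g, hg, hgf⟩ := hQ (Set.range b) (Set.finite_range b) f (by
        constructor
        · rintro _ ⟨i, rfl⟩ _ ⟨j, rfl⟩ h
          rw [hf, hf] at h
          exact (H2 _ (aux_eq hK i j)).2 h
        · rintro ⟨k, σ⟩ hσ a ha
          choose h hh using ha
          have e1 : a = b ∘ h := funext fun i => (hh i).symm
          have e2 : f ∘ a = c ∘ h := by
            rw [e1]; exact funext fun i => hf (h i)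
          rw [e2, e1]
          exact H2 _ (aux_subst hK σ (hQR hσ) h))
      have e : ⇑g ∘ b = c := funext fun i => (hgf _ ⟨i, rfl⟩).trans (hf i)
      exact ((aux_perm g ρ).1 (hρ g hg) b).2 (e ▸ hc)
    have : ρ = ⋂₀ {σ | (⟨m, σ⟩ : Rels A) ∈ R ∧ ρ ⊆ σ} := by
      apply Set.Subset.antisymm
      · exact Set.subset_sInter fun σ hσ => hσ.2
      · intro b hb
        by_contra hbρ
        have hΓ := hI.2 m {σ | (⟨m, σ⟩ : Rels A) ∈ R ∧ b ∈ σ} (fun σ hσ => hσ.1)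
        refine hb _ ⟨aux_compl hK _ hΓ, fun c hc hcΓ => hbρ ?_⟩ (fun σ hσ => hσ.2)
        exact key b c (fun σ hσ hbσ => hcΓ σ ⟨hσ, hbσ⟩) hc
    rw [this]
    exact hI.2 m _ (fun σ hσ => hσ.1)
end

section
/- For every set Q of finitary relations on a nonempty set A, ⟨Q⟩_inv = ⋃{ sInv Aut Q_0 : Q_0 ⊆ Q, Q_0 finite }; i.e. the closure operator Q ↦ ⟨Q⟩_inv is the algebraic part of sInv Aut. -/
open FirstOrder

/-- An invariant (finitary) operation on relations. -/
def Invariant {A : Type*} {n : ℕ} {k : Fin n → ℕ} {m : ℕ}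
    (F : (∀ i : Fin n, Set (Fin (k i + 1) → A)) → Set (Fin (m + 1) → A)) : Prop :=
  ∀ (g : Equiv.Perm A) (ρ : ∀ i : Fin n, Set (Fin (k i + 1) → A)),
    F (fun i => permImage g (ρ i)) = permImage g (F ρ)

/-- `R` is closed under all invariant (finitary) operations. -/
def InvClosed {A : Type*} (R : Set (Rels A)) : Prop :=
  ∀ (n : ℕ) (k : Fin n → ℕ) (m : ℕ)
    (F : (∀ i : Fin n, Set (Fin (k i + 1) → A)) → Set (Fin (m + 1) → A)),
    Invariant F → ∀ ρ : ∀ i : Fin n, Set (Fin (k i + 1) → A),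
      (∀ i, (⟨k i, ρ i⟩ : Rels A) ∈ R) → (⟨m, F ρ⟩ : Rels A) ∈ R

/-- `⟨Q⟩_inv`: the closure of `Q` under all invariant operations. -/
def invClosure {A : Type*} (Q : Set (Rels A)) : Set (Rels A) :=
  ⋂₀ {R | Q ⊆ R ∧ InvClosed R}

theorem permImage_mul' {A : Type*} (g h : Equiv.Perm A) {m : ℕ} (ρ : Set (Fin m → A)) :
    permImage (g * h) ρ = permImage g (permImage h ρ) := by
  unfold permImage
  rw [Set.image_image]
  rfl

theorem permImage_one' {A : Type*} {m : ℕ} (ρ : Set (Fin m → A)) :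
    permImage 1 ρ = ρ := by
  unfold permImage
  exact Set.image_id ρ

theorem permImage_mono' {A : Type*} (g : Equiv.Perm A) {m : ℕ} {ρ σ : Set (Fin m → A)}
    (h : ρ ⊆ σ) : permImage g ρ ⊆ permImage g σ := Set.image_mono h

/-- For every set `Q` of finitary relations on a nonempty set
`A`, `⟨Q⟩_inv = ⋃ { sInv Aut Q₀ : Q₀ ⊆ Q finite }`; i.e. `⟨-⟩_inv` is the
algebraic part of `sInv Aut`. -/
theorem stmt10 {A : Type*} [Nonempty A] (Q : Set (Rels A)) :
    invClosure Q = {ρ : Rels A | ∃ Q₀ : Set (Rels A), Q₀ ⊆ Q ∧ Q₀.Finite ∧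
      ρ ∈ sInvG (AutR Q₀)} := by
  apply Set.Subset.antisymm
  · apply Set.sInter_subset_of_mem
    refine ⟨?_, ?_⟩
    · intro ρ hρ
      refine ⟨{ρ}, by simpa using hρ, Set.finite_singleton ρ, ?_⟩
      intro g hg
      exact hg ρ rfl
    · intro n k m F hF ρ hρ
      choose Q' h1 h2 h3 using hρ
      refine ⟨⋃ i, Q' i, Set.iUnion_subset h1, Set.finite_iUnion h2, ?_⟩
      intro g hg
      have key : (fun i => permImage g (ρ i)) = ρ := by
        funext i
        exact h3 i g (fun τ hτ => hg τ (Set.mem_iUnion.2 ⟨i, hτ⟩))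
      have := hF g ρ
      rw [key] at this
      exact this.symm
  · rintro ⟨m, ρ⟩ ⟨Q₀, hQ, hfin, hρ⟩ R ⟨hQR, hR⟩
    obtain ⟨n, f, hf⟩ : ∃ (n : ℕ) (f : Fin n → Rels A), Set.range f = Q₀ := by
      obtain ⟨n, f, hf⟩ := hfin.fin_param
      exact ⟨n, f, hf.2⟩
    let F : (∀ i : Fin n, Set (Fin ((f i).1 + 1) → A)) → Set (Fin (m + 1) → A) :=
      fun σ => ⋃ g ∈ {g : Equiv.Perm A | ∀ i, permImage g (f i).2 = σ i}, permImage g ρ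
    have hsub : ∀ g σ, F (fun i => permImage g (σ i)) ⊆ permImage g (F σ) := by
      intro g σ
      refine Set.iUnion₂_subset fun h hh => ?_
      have : permImage h ρ = permImage g (permImage (g⁻¹ * h) ρ) := by
        rw [← permImage_mul', mul_inv_cancel_left]
      rw [this]
      apply permImage_mono'
      refine Set.subset_biUnion_of_mem (u := fun g => permImage g ρ) ?_
      intro i
      rw [permImage_mul', hh i, ← permImage_mul', inv_mul_cancel, permImage_one']
    have hF : Invariant F := by
      intro g σ
      apply Set.Subset.antisymm (hsub g σ)
      have h := permImage_mono' g (hsub g⁻¹ (fun i => permImage g (σ i)))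
      simpa only [← permImage_mul', inv_mul_cancel, mul_inv_cancel, permImage_one'] using h
    have hFf : F (fun i => (f i).2) = ρ := by
      apply Set.Subset.antisymm
      · refine Set.iUnion₂_subset fun g hg => ?_
        refine (hρ g ?_).subset
        intro τ hτ
        rw [← hf] at hτ
        obtain ⟨i, rfl⟩ := hτ
        exact hg i
      · have := Set.subset_biUnion_of_mem (s := {g : Equiv.Perm A | ∀ i, permImage g (f i).2 = (f i).2})
          (u := fun g => permImage g ρ) (x := 1) (fun i => permImage_one' _)
        simpa only [permImage_one'] using this
    have := hR n (fun i => (f i).1) m F hF (fun i => (f i).2)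
      (fun i => hQR (hQ (hf ▸ Set.mem_range_self i)))
    rw [hFf] at this
    exact this
end
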